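/- arXiv:2510.09383 — 3 statements merged into one kernel-verified Lean document; each statement's English description precedes it below -/
import Mathlib

section
/- Let f, u : ℝⁿ → ℝ be smooth ℤⁿ-periodic functions. Then ∫_{[0,1]ⁿ} |D²u(x)|² e^{-f(x)} dx = ∫_{[0,1]ⁿ} (Δ_f u(x))² e^{-f(x)} dx − ∫_{[0,1]ⁿ} ∇u(x)·(D²f(x) ∇u(x)) e^{-f(x)} dx, where Δ_f u = Δu − ∇f·∇u. -/
noncomputable section

open MeasureTheory

variable {n : ℕ}

/-- `i`-th partial derivative. -/
def pderiv1 (u : (Fin n → ℝ) → ℝ) (i : Fin n) (x : Fin n → ℝ) : ℝ :=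
  fderiv ℝ u x (Pi.single i 1)

/-- Gradient. -/
def grad (u : (Fin n → ℝ) → ℝ) (x : Fin n → ℝ) : Fin n → ℝ :=
  fun i => pderiv1 u i x

/-- Hessian matrix. -/
def hess (u : (Fin n → ℝ) → ℝ) (x : Fin n → ℝ) : Matrix (Fin n) (Fin n) ℝ :=
  Matrix.of fun i j => pderiv1 (pderiv1 u j) i x

/-- Laplacian. -/
def lap (u : (Fin n → ℝ) → ℝ) (x : Fin n → ℝ) : ℝ :=
  ∑ i, pderiv1 (pderiv1 u i) i x

/-- Euclidean dot product. -/
def dot (a b : Fin n → ℝ) : ℝ := ∑ i, a i * b i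

/-- ℤⁿ-periodicity. -/
def ZPeriodic (u : (Fin n → ℝ) → ℝ) : Prop :=
  ∀ (x : Fin n → ℝ) (k : Fin n → ℤ), u (x + fun i => (k i : ℝ)) = u x

/-- Area element `Q(p) = √(1+|p|²)`. -/
def Qe (p : Fin n → ℝ) : ℝ := Real.sqrt (1 + ∑ i, p i ^ 2)

/-- `v(p) = p / √(1+|p|²)`. -/
def vv (p : Fin n → ℝ) : Fin n → ℝ := fun i => p i / Qe p

/-- Divergence of a vector field. -/
def dvg (V : (Fin n → ℝ) → (Fin n → ℝ)) (x : Fin n → ℝ) : ℝ :=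
  ∑ i, fderiv ℝ (fun y => V y i) x (Pi.single i 1)

/-- Weighted divergence `div_f V = div V − ∇f·V`. -/
def divf (f : (Fin n → ℝ) → ℝ) (V : (Fin n → ℝ) → (Fin n → ℝ)) (x : Fin n → ℝ) : ℝ :=
  dvg V x - dot (grad f x) (V x)

/-- Frobenius inner product of matrices. -/
def frob (A B : Matrix (Fin n) (Fin n) ℝ) : ℝ := ∑ i, ∑ j, A i j * B i j

lemma ContDiff.pderiv1 {u : (Fin n → ℝ) → ℝ} (hu : ContDiff ℝ (⊤ : ℕ∞) u) (i : Fin n) :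
    ContDiff ℝ (⊤ : ℕ∞) (pderiv1 u i) :=
  (hu.fderiv_right (m := (⊤ : ℕ∞)) (by norm_cast)).clm_apply contDiff_const

lemma ContDiff.differentiableAt_of_top {u : (Fin n → ℝ) → ℝ} (hu : ContDiff ℝ (⊤ : ℕ∞) u)
    (x : Fin n → ℝ) : DifferentiableAt ℝ u x :=
  hu.differentiable (by simp) x

lemma ZPeriodic.pderiv1 {u : (Fin n → ℝ) → ℝ} (hu : ZPeriodic u) (i : Fin n) :
    ZPeriodic (pderiv1 u i) := by
  intro x k
  have h : (fun y => u (y + fun i => (k i : ℝ))) = u := funext fun y => hu y k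
  unfold _root_.pderiv1
  rw [← fderiv_comp_add_right, h]

lemma pderiv1_mul {a b : (Fin n → ℝ) → ℝ} {x : Fin n → ℝ} (ha : DifferentiableAt ℝ a x)
    (hb : DifferentiableAt ℝ b x) (i : Fin n) :
    pderiv1 (fun y => a y * b y) i x = pderiv1 a i x * b x + a x * pderiv1 b i x := by
  simp only [pderiv1, fderiv_fun_mul ha hb]
  simp
  ring

lemma pderiv1_sub {a b : (Fin n → ℝ) → ℝ} {x : Fin n → ℝ} (ha : DifferentiableAt ℝ a x)
    (hb : DifferentiableAt ℝ b x) (i : Fin n) :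
    pderiv1 (fun y => a y - b y) i x = pderiv1 a i x - pderiv1 b i x := by
  simp [pderiv1, fderiv_fun_sub ha hb]

lemma pderiv1_sum {a : Fin n → (Fin n → ℝ) → ℝ} {x : Fin n → ℝ}
    (ha : ∀ j, DifferentiableAt ℝ (a j) x) (i : Fin n) :
    pderiv1 (fun y => ∑ j, a j y) i x = ∑ j, pderiv1 (a j) i x := by
  simp [pderiv1, fderiv_fun_sum fun j _ => ha j]

lemma pderiv1_exp_neg {f : (Fin n → ℝ) → ℝ} {x : Fin n → ℝ} (hf : DifferentiableAt ℝ f x)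
    (i : Fin n) :
    pderiv1 (fun y => Real.exp (-f y)) i x = -(pderiv1 f i x * Real.exp (-f x)) := by
  simp only [pderiv1, fderiv_exp hf.fun_neg, fderiv_fun_neg]
  simp
  ring

/-- Second partial derivatives of a smooth function commute. -/
lemma pderiv1_comm {u : (Fin n → ℝ) → ℝ} (hu : ContDiff ℝ (⊤ : ℕ∞) u) (i j : Fin n) :
    pderiv1 (pderiv1 u i) j = pderiv1 (pderiv1 u j) i := by
  funext x
  have hd : DifferentiableAt ℝ (fderiv ℝ u) x :=
    (hu.fderiv_right (m := (⊤ : ℕ∞)) (by norm_cast)).differentiable (by simp) x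
  have key (k l : Fin n) : pderiv1 (pderiv1 u k) l x =
      fderiv ℝ (fderiv ℝ u) x (Pi.single l 1) (Pi.single k 1) := by
    change fderiv ℝ (fun y => fderiv ℝ u y (Pi.single k 1)) x _ = _
    rw [fderiv_clm_apply hd (differentiableAt_const _)]
    simp
  rw [key, key]
  exact (hu.contDiffAt.isSymmSndFDerivAt (by simp; norm_cast)) _ _

/-- The divergence of a smooth periodic vector field integrates to zero over the unit cube. -/
lemma integral_dvg_eq_zero (V : Fin n → (Fin n → ℝ) → ℝ)
    (hV : ∀ i, ContDiff ℝ (⊤ : ℕ∞) (V i)) (hp : ∀ i, ZPeriodic (V i)) :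
    ∫ x in Set.Icc (0 : Fin n → ℝ) 1, ∑ i, pderiv1 (V i) i x = 0 := by
  obtain _ | n := n
  · simp
  have hint : IntegrableOn (fun x => ∑ i, pderiv1 (V i) i x) (Set.Icc (0 : Fin (n + 1) → ℝ) 1) :=
    (continuous_finsetSum _ fun i _ => ((hV i).pderiv1 i).continuous).integrableOn_Icc
  have h := integral_divergence_of_hasFDerivAt_off_countable' (E := ℝ) 0 1
    (zero_le_one : (0 : Fin (n + 1) → ℝ) ≤ 1) V (fun i => fderiv ℝ (V i)) ∅ Set.countable_empty
    (fun i => (hV i).continuous.continuousOn)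
    (fun x _ i => ((hV i).differentiableAt_of_top x).hasFDerivAt) hint
  refine h.trans (Finset.sum_eq_zero fun i _ => sub_eq_zero.2 ?_)
  congr 1
  funext x
  rw [← hp i (i.insertNth ((0 : Fin (n + 1) → ℝ) i) x) (Pi.single i 1)]
  congr 1
  funext k
  refine Fin.succAboveCases i ?_ (fun j => ?_) k <;> simp

/-- The divergence of `e^{-f} (D²u ∇u − Δ_f u ∇u)` is the weighted sum of the three integrands
of the Bochner identity. -/
lemma dvg_bochner_field {f u : (Fin n → ℝ) → ℝ}
    (hf : ContDiff ℝ (⊤ : ℕ∞) f) (hu : ContDiff ℝ (⊤ : ℕ∞) u) (x : Fin n → ℝ) :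
    ∑ i, pderiv1 (fun y => Real.exp (-f y) * (∑ j, pderiv1 (pderiv1 u j) i y * pderiv1 u j y
        - (∑ j, pderiv1 (pderiv1 u j) j y - ∑ j, pderiv1 f j y * pderiv1 u j y)
          * pderiv1 u i y)) i x =
      frob (hess u x) (hess u x) * Real.exp (-f x)
        - (lap u x - dot (grad f x) (grad u x)) ^ 2 * Real.exp (-f x)
        + dot (grad u x) ((hess f x).mulVec (grad u x)) * Real.exp (-f x) := by
  have hd : DifferentiableAt ℝ f x := hf.differentiableAt_of_top x
  have df (j) : DifferentiableAt ℝ (pderiv1 f j) x := (hf.pderiv1 j).differentiableAt_of_top x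
  have du (j) : DifferentiableAt ℝ (pderiv1 u j) x := (hu.pderiv1 j).differentiableAt_of_top x
  have duu (j k) : DifferentiableAt ℝ (pderiv1 (pderiv1 u j) k) x :=
    ((hu.pderiv1 j).pderiv1 k).differentiableAt_of_top x
  have third (i j) : pderiv1 (pderiv1 (pderiv1 u j) i) i x =
      pderiv1 (pderiv1 (pderiv1 u i) i) j x := by
    rw [pderiv1_comm hu j i, pderiv1_comm (hu.pderiv1 i) j i]
  have expand (i : Fin n) : pderiv1 (fun y => Real.exp (-f y) *
      (∑ j, pderiv1 (pderiv1 u j) i y * pderiv1 u j y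
        - (∑ j, pderiv1 (pderiv1 u j) j y - ∑ j, pderiv1 f j y * pderiv1 u j y)
          * pderiv1 u i y)) i x =
      Real.exp (-f x) * (
        - ∑ j, pderiv1 f i x * (pderiv1 (pderiv1 u j) i x * pderiv1 u j x)
        + (∑ j, pderiv1 f j x * pderiv1 (pderiv1 u j) i x * pderiv1 u i x)
        + (∑ j, pderiv1 (pderiv1 (pderiv1 u i) i) j x * pderiv1 u j x)
        - (∑ j, pderiv1 (pderiv1 (pderiv1 u j) j) i x * pderiv1 u i x)
        + (∑ j, pderiv1 (pderiv1 u j) i x * pderiv1 (pderiv1 u j) i x)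
        + (∑ j, pderiv1 u i x * (pderiv1 (pderiv1 f j) i x * pderiv1 u j x))
        + (lap u x - dot (grad f x) (grad u x)) *
          (pderiv1 f i x * pderiv1 u i x - pderiv1 (pderiv1 u i) i x)) := by
    rw [pderiv1_mul (by fun_prop) (by fun_prop), pderiv1_exp_neg hd,
      pderiv1_sub (by fun_prop) (by fun_prop), pderiv1_sum (by fun_prop),
      pderiv1_mul (by fun_prop) (by fun_prop),
      pderiv1_sub (by fun_prop) (by fun_prop), pderiv1_sum (by fun_prop),
      pderiv1_sum (by fun_prop)]
    simp only [pderiv1_mul (duu _ _) (du _), pderiv1_mul (df _) (du _), third, lap, dot, grad,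
      Finset.sum_add_distrib, ← Finset.mul_sum, ← Finset.sum_mul]
    ring
  simp only [expand, ← Finset.mul_sum, Finset.sum_add_distrib, Finset.sum_sub_distrib,
    Finset.sum_neg_distrib]
  have s1 : ∑ i, ∑ j, pderiv1 f j x * pderiv1 (pderiv1 u j) i x * pderiv1 u i x =
      ∑ i, pderiv1 f i x * ∑ j, pderiv1 (pderiv1 u j) i x * pderiv1 u j x := by
    rw [Finset.sum_comm]
    simp only [Finset.mul_sum]
    refine Finset.sum_congr rfl fun i _ => Finset.sum_congr rfl fun j _ => ?_
    rw [pderiv1_comm hu i j, mul_assoc]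
  have s2 : ∑ i, ∑ j, pderiv1 (pderiv1 (pderiv1 u i) i) j x * pderiv1 u j x =
      ∑ i, ∑ j, pderiv1 (pderiv1 (pderiv1 u j) j) i x * pderiv1 u i x := Finset.sum_comm
  rw [s1, s2]
  simp only [frob, hess, lap, dot, grad, Matrix.mulVec, dotProduct, Matrix.of_apply]
  ring

/-- weighted Bochner identity:
`∫ |D²u|² e^{-f} = ∫ (Δ_f u)² e^{-f} − ∫ ∇u·(D²f ∇u) e^{-f}` over `[0,1]ⁿ`
for smooth ℤⁿ-periodic `f, u`, where `Δ_f u = Δu − ∇f·∇u`. -/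
theorem weighted_bochner_identity
    (f u : (Fin n → ℝ) → ℝ)
    (hf : ContDiff ℝ (⊤ : ℕ∞) f) (hu : ContDiff ℝ (⊤ : ℕ∞) u)
    (hfp : ZPeriodic f) (hup : ZPeriodic u) :
    ∫ x in Set.Icc (0 : Fin n → ℝ) 1, frob (hess u x) (hess u x) * Real.exp (-f x) =
      (∫ x in Set.Icc (0 : Fin n → ℝ) 1,
          (lap u x - dot (grad f x) (grad u x)) ^ 2 * Real.exp (-f x))
      - ∫ x in Set.Icc (0 : Fin n → ℝ) 1,
          dot (grad u x) ((hess f x).mulVec (grad u x)) * Real.exp (-f x) := by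
  have hcu i : ContDiff ℝ (⊤ : ℕ∞) (pderiv1 u i) := hu.pderiv1 i
  have hcf i : ContDiff ℝ (⊤ : ℕ∞) (pderiv1 f i) := hf.pderiv1 i
  have hcuu i j : ContDiff ℝ (⊤ : ℕ∞) (pderiv1 (pderiv1 u i) j) := (hcu i).pderiv1 j
  have c0 : Continuous f := hf.continuous
  have cu i : Continuous (pderiv1 u i) := (hcu i).continuous
  have cf i : Continuous (pderiv1 f i) := (hcf i).continuous
  have cuu i j : Continuous (pderiv1 (pderiv1 u i) j) := (hcuu i j).continuous
  have cff i j : Continuous (pderiv1 (pderiv1 f i) j) := ((hcf i).pderiv1 j).continuous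
  have h := integral_dvg_eq_zero (fun i y => Real.exp (-f y) *
      (∑ j, pderiv1 (pderiv1 u j) i y * pderiv1 u j y
        - (∑ j, pderiv1 (pderiv1 u j) j y - ∑ j, pderiv1 f j y * pderiv1 u j y)
          * pderiv1 u i y)) (fun i => by fun_prop) (fun i x k => by
      simp only [hfp x k, hfp.pderiv1 _ x k, hup.pderiv1 _ x k, (hup.pderiv1 _).pderiv1 _ x k])
  simp only [dvg_bochner_field hf hu] at h
  rw [integral_add, integral_sub] at h
  · linarith
  all_goals
    refine Continuous.integrableOn_Icc ?_
    simp only [frob, hess, lap, dot, grad, Matrix.mulVec, dotProduct, Matrix.of_apply]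
    fun_prop
end
end

section
/- Let h : [1,∞) → ℝ be twice continuously differentiable, nonnegative, nondecreasing, and convex, with h'(1) − h(1) ≥ 0. Then for every p ∈ ℝⁿ, writing Q = Q(p) and v = v(p), the symmetric matrix (h'(Q)/Q − h(Q)/(2Q²))·Id + (h''(Q) − h'(Q)/Q + h(Q)/(2Q²))·(v vᵀ) is positive semidefinite. -/
noncomputable section

open MeasureTheory

variable {n : ℕ}

lemma posSemidef_vecMulVec_self (v : Fin n → ℝ) : (Matrix.vecMulVec v v).PosSemidef := by
  simpa using Matrix.posSemidef_vecMulVec_self_star v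

lemma posSemidef_one_sub_vecMulVec_self {v : Fin n → ℝ} (hv : ∑ i, v i ^ 2 ≤ 1) :
    (1 - Matrix.vecMulVec v v).PosSemidef := by
  refine .of_dotProduct_mulVec_nonneg
    (Matrix.isHermitian_one.sub (posSemidef_vecMulVec_self v).isHermitian) fun w => ?_
  have hw : 0 ≤ ∑ i, w i ^ 2 := Finset.sum_nonneg fun i _ => sq_nonneg _
  have hform : star w ⬝ᵥ (1 - Matrix.vecMulVec v v).mulVec w
      = ∑ i, w i ^ 2 - (∑ i, v i * w i) ^ 2 := by
    rw [Matrix.sub_mulVec, Matrix.one_mulVec, dotProduct_sub, Matrix.vecMulVec_mulVec]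
    simp only [dotProduct, Pi.smul_apply, MulOpposite.smul_eq_mul_unop, MulOpposite.unop_op,
      star_trivial, ← mul_assoc, ← Finset.sum_mul, sq, mul_comm (w _) (v _)]
  rw [hform, sub_nonneg]
  exact (Finset.sum_mul_sq_le_sq_mul_sq _ _ _).trans (mul_le_of_le_one_left hw hv)

lemma one_le_Qe (p : Fin n → ℝ) : 1 ≤ Qe p :=
  Real.one_le_sqrt.2 (le_add_of_nonneg_right (Finset.sum_nonneg fun i _ => sq_nonneg (p i)))

lemma sum_vv_sq_le_one (p : Fin n → ℝ) : ∑ i, vv p i ^ 2 ≤ 1 := by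
  have hp : 0 ≤ ∑ i, p i ^ 2 := Finset.sum_nonneg fun i _ => sq_nonneg (p i)
  have hQ : Qe p ^ 2 = 1 + ∑ i, p i ^ 2 := Real.sq_sqrt (by positivity)
  simp only [vv, div_pow, ← Finset.sum_div, hQ]
  exact div_le_one_of_le₀ (by linarith) (by linarith)

/-- A differentiable convex function on `[1, ∞)` with `h 1 ≤ h' 1` satisfies `h x ≤ x * h' x`. -/
lemma ConvexOn.le_mul_derivWithin_Ici_one {h : ℝ → ℝ} (hconv : ConvexOn ℝ (Set.Ici 1) h)
    (hd : DifferentiableOn ℝ h (Set.Ici 1)) (h1 : h 1 ≤ derivWithin h (Set.Ici 1) 1)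
    {x : ℝ} (hx : 1 ≤ x) : h x ≤ x * derivWithin h (Set.Ici 1) x := by
  rcases hx.eq_or_lt with rfl | hlt
  · simpa using h1
  have hone : (1 : ℝ) ∈ Set.Ici 1 := Set.self_mem_Ici
  have hslope := hconv.slope_le_derivWithin hone hx hlt (hd x hx)
  rw [slope_def_field, div_le_iff₀ (sub_pos.2 hlt)] at hslope
  have hmono := hconv.monotoneOn_derivWithin hd hone hx hx
  linarith

/-- for `h ∈ C²([1,∞))` nonnegative, nondecreasing, convex, with
`h'(1) − h(1) ≥ 0`, the matrix
`(h'(Q)/Q − h(Q)/(2Q²))·Id + (h''(Q) − h'(Q)/Q + h(Q)/(2Q²))·(v vᵀ)`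
is positive semidefinite for every `p ∈ ℝⁿ`, where `Q = Q(p)`, `v = v(p)`. -/
theorem key_matrix_psd
    (h : ℝ → ℝ) (hh : ContDiffOn ℝ 2 h (Set.Ici 1))
    (hpos : ∀ x ∈ Set.Ici (1 : ℝ), 0 ≤ h x)
    (hmono : MonotoneOn h (Set.Ici 1))
    (hconv : ConvexOn ℝ (Set.Ici 1) h)
    (h1 : 0 ≤ derivWithin h (Set.Ici 1) 1 - h 1)
    (p : Fin n → ℝ) :
    Matrix.PosSemidef
      ((derivWithin h (Set.Ici 1) (Qe p) / Qe p - h (Qe p) / (2 * Qe p ^ 2)) •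
          (1 : Matrix (Fin n) (Fin n) ℝ)
        + (derivWithin (derivWithin h (Set.Ici 1)) (Set.Ici 1) (Qe p)
            - derivWithin h (Set.Ici 1) (Qe p) / Qe p + h (Qe p) / (2 * Qe p ^ 2)) •
          Matrix.vecMulVec (vv p) (vv p)) := by
  set Q := Qe p
  set d := derivWithin h (Set.Ici 1) Q
  set d₂ := derivWithin (derivWithin h (Set.Ici 1)) (Set.Ici 1) Q
  have hQ : 1 ≤ Q := one_le_Qe p
  have hd : DifferentiableOn ℝ h (Set.Ici 1) := hh.differentiableOn (by norm_num)
  have hle : h Q ≤ Q * d := hconv.le_mul_derivWithin_Ici_one hd (sub_nonneg.1 h1) hQ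
  have hd₂ : 0 ≤ d₂ := (hconv.monotoneOn_derivWithin hd).derivWithin_nonneg
  have ha : 0 ≤ d / Q - h Q / (2 * Q ^ 2) := by
    have heq : d / Q - h Q / (2 * Q ^ 2) = (2 * (Q * d) - h Q) / (2 * Q ^ 2) := by
      field_simp
    rw [heq]
    have := hpos Q hQ
    exact div_nonneg (by linarith) (by positivity)
  have key := ((posSemidef_one_sub_vecMulVec_self (sum_vv_sq_le_one p)).smul ha).add
    ((posSemidef_vecMulVec_self (vv p)).smul hd₂)
  convert key using 1
  module
end
end

section
/- Let A ∈ ℝ^{n×n} be a symmetric matrix and v ∈ ℝⁿ with |v| ≤ 1. Then |A|² − 2|Av|² + (v·Av)² ≥ 0, where |A| denotes the Frobenius norm of A and |Av| the Euclidean norm of the vector Av. -/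
noncomputable section

open MeasureTheory

variable {n : ℕ}

open Matrix in
/-- Frobenius norm of `(1 - k v vᵀ) A (1 - k v vᵀ)` for symmetric `A`. -/
theorem sum_sq_rank_one_compression {ι : Type*} [Fintype ι] {A : Matrix ι ι ℝ}
    (hA : A.IsSymm) (v : ι → ℝ) (k : ℝ) :
    ∑ i, ∑ j, (A i j - k * (A *ᵥ v) i * v j - k * v i * (A *ᵥ v) j
        + k ^ 2 * (∑ l, v l * (A *ᵥ v) l) * v i * v j) ^ 2 =
      (∑ i, ∑ j, A i j ^ 2) - 2 * (2 * k - k ^ 2 * ∑ l, v l ^ 2) * ∑ i, (A *ᵥ v) i ^ 2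
        + (2 * k - k ^ 2 * ∑ l, v l ^ 2) ^ 2 * (∑ l, v l * (A *ᵥ v) l) ^ 2 := by
  have hrow : ∀ i, ∑ j, A i j * v j = (A *ᵥ v) i := fun _ => rfl
  have hAw : ∑ i, v i * ∑ j, A i j * (A *ᵥ v) j = ∑ i, (A *ᵥ v) i ^ 2 := by
    simp only [Finset.mul_sum]
    rw [Finset.sum_comm]
    refine Finset.sum_congr rfl fun j _ => ?_
    rw [sq, ← hrow j, Finset.sum_mul]
    refine Finset.sum_congr rfl fun i _ => ?_
    rw [hrow, ← hA.apply i j]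
    ring
  generalize A *ᵥ v = w at *
  set c := ∑ l, v l * w l with hc
  set s := ∑ l, v l ^ 2 with hs
  have hinner : ∀ i, ∑ j, (A i j - k * w i * v j - k * v i * w j
        + k ^ 2 * c * v i * v j) ^ 2 =
      ∑ j, A i j ^ 2 + (k ^ 2 * c * v i - k * w i) ^ 2 * s + k ^ 2 * v i ^ 2 * ∑ j, w j ^ 2
        + 2 * (k ^ 2 * c * v i - k * w i) * w i - 2 * k * (v i * ∑ j, A i j * w j)
        - 2 * k * v i * (k ^ 2 * c * v i - k * w i) * c := by
    intro i
    have : ∀ j, (A i j - k * w i * v j - k * v i * w j + k ^ 2 * c * v i * v j) ^ 2 =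
        A i j ^ 2 + (k ^ 2 * c * v i - k * w i) ^ 2 * v j ^ 2 + k ^ 2 * v i ^ 2 * w j ^ 2
        + 2 * (k ^ 2 * c * v i - k * w i) * (A i j * v j) - 2 * k * v i * (A i j * w j)
        - 2 * k * v i * (k ^ 2 * c * v i - k * w i) * (v j * w j) := fun j => by ring
    simp only [this, Finset.sum_add_distrib, Finset.sum_sub_distrib, ← Finset.mul_sum, hrow,
      ← hc, ← hs]
    ring
  have houter : ∀ i, (k ^ 2 * c * v i - k * w i) ^ 2 * s + k ^ 2 * v i ^ 2 * ∑ j, w j ^ 2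
        + 2 * (k ^ 2 * c * v i - k * w i) * w i
        - 2 * k * v i * (k ^ 2 * c * v i - k * w i) * c =
      (k ^ 4 * c ^ 2 * s + k ^ 2 * (∑ j, w j ^ 2) - 2 * k ^ 3 * c ^ 2) * v i ^ 2
        + (k ^ 2 * s - 2 * k) * w i ^ 2
        + (4 * k ^ 2 * c - 2 * k ^ 3 * c * s) * (v i * w i) := fun i => by ring
  have hsplit : ∀ i, ∑ j, (A i j - k * w i * v j - k * v i * w j
        + k ^ 2 * c * v i * v j) ^ 2 =
      ∑ j, A i j ^ 2 - 2 * k * (v i * ∑ j, A i j * w j)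
        + ((k ^ 4 * c ^ 2 * s + k ^ 2 * (∑ j, w j ^ 2) - 2 * k ^ 3 * c ^ 2) * v i ^ 2
        + (k ^ 2 * s - 2 * k) * w i ^ 2
        + (4 * k ^ 2 * c - 2 * k ^ 3 * c * s) * (v i * w i)) := fun i => by
    rw [hinner, ← houter]; ring
  simp only [hsplit, Finset.sum_add_distrib, Finset.sum_sub_distrib, ← Finset.mul_sum, hAw,
    ← hc, ← hs]
  ring

/-- for symmetric `A` and `|v| ≤ 1`,
`|A|² − 2|Av|² + (v·Av)² ≥ 0`. -/
theorem frobenius_projection_nonneg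
    (A : Matrix (Fin n) (Fin n) ℝ) (hA : A.IsSymm)
    (v : Fin n → ℝ) (hv : Real.sqrt (∑ i, v i ^ 2) ≤ 1) :
    0 ≤ (∑ i, ∑ j, A i j ^ 2) - 2 * (∑ i, (A.mulVec v i) ^ 2)
        + (dot v (A.mulVec v)) ^ 2 := by
  have hs : ∑ i, v i ^ 2 ≤ 1 := by simpa using (Real.sqrt_le_iff.mp hv).2
  set r := Real.sqrt (1 - ∑ i, v i ^ 2) with hr
  have hr0 : 0 ≤ r := Real.sqrt_nonneg _
  have hr2 : r ^ 2 = 1 - ∑ i, v i ^ 2 := Real.sq_sqrt (by linarith)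
  have hk : 2 * (1 + r)⁻¹ - (1 + r)⁻¹ ^ 2 * ∑ i, v i ^ 2 = 1 := by
    rw [show ∑ i, v i ^ 2 = 1 - r ^ 2 by linarith]
    field_simp
    ring
  have h := sum_sq_rank_one_compression hA v (1 + r)⁻¹
  rw [hk, mul_one, one_pow, one_mul] at h
  rw [dot, ← h]
  positivity
end
end
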